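/- Let D be an H-colored quasi-transitive digraph. If k ≥ 4, then D has a (k,H)-kernel. -/

import Mathlib

/-!
Setting: `A : V → V → Prop` is the arc relation of a loopless digraph `D`,
`AH : VH → VH → Prop` is the arc relation of a digraph `H` (possibly with loops),
and `ρ : V → V → VH` colors each arc of `D` with a vertex of `H`
(`D` is an `H`-colored digraph).
-/

open scoped Classical

noncomputable section

variable {V VH : Type*}

/-- `x 0, x 1, …, x n` is a walk of length `n` in the digraph with arc relation `A`. -/
def IsWalk (A : V → V → Prop) (n : ℕ) (x : ℕ → V) : Prop :=
  ∀ i < n, A (x i) (x (i + 1))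

/-- A (directed) path of length `n`: a walk whose `n + 1` vertices are pairwise distinct. -/
def IsPath (A : V → V → Prop) (n : ℕ) (x : ℕ → V) : Prop :=
  IsWalk A n x ∧ ∀ i ≤ n, ∀ j ≤ n, x i = x j → i = j

/-- A (directed) cycle of length `n`: a nontrivial closed walk whose first `n` vertices are
pairwise distinct. -/
def IsCycle (A : V → V → Prop) (n : ℕ) (x : ℕ → V) : Prop :=
  IsWalk A n x ∧ x n = x 0 ∧ 1 ≤ n ∧ ∀ i < n, ∀ j < n, x i = x j → i = j

/-- The set `O_H(W)` of obstructions of an open walk `W = (x 0, …, x n)`: the indices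
`i ∈ {1, …, n-1}` such that `(ρ(x_{i-1}, x_i), ρ(x_i, x_{i+1}))` is not an arc of `H`. -/
def obstrOpen (AH : VH → VH → Prop) (ρ : V → V → VH) (n : ℕ) (x : ℕ → V) : Finset ℕ :=
  (Finset.Ico 1 n).filter fun i => ¬ AH (ρ (x (i - 1)) (x i)) (ρ (x i) (x (i + 1)))

/-- The set `O_H(W)` of obstructions of a closed walk `W = (x 0, …, x n)` (`x n = x 0`):
the indices `i ∈ {0, …, n-1}`, taken modulo `n`, such that
`(ρ(x_{i-1}, x_i), ρ(x_i, x_{i+1}))` is not an arc of `H`. -/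
def obstrClosed (AH : VH → VH → Prop) (ρ : V → V → VH) (n : ℕ) (x : ℕ → V) : Finset ℕ :=
  (Finset.range n).filter fun i =>
    ¬ AH (ρ (x (if i = 0 then n - 1 else i - 1)) (x i)) (ρ (x i) (x (i + 1)))

/-- The `H`-length of an open walk: `|O_H(W)| + 1`. -/
def HLenOpen (AH : VH → VH → Prop) (ρ : V → V → VH) (n : ℕ) (x : ℕ → V) : ℕ :=
  (obstrOpen AH ρ n x).card + 1

/-- The `H`-length of a closed walk: `|O_H(W)|`. -/
def HLenClosed (AH : VH → VH → Prop) (ρ : V → V → VH) (n : ℕ) (x : ℕ → V) : ℕ :=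
  (obstrClosed AH ρ n x).card

/-- `(u,v)` is an arc of the `(l,H)`-closure `C_H^l(D)` iff there exists a `uv`-path in `D`
with `H`-length at most `l`. -/
def ClosureAdj (A : V → V → Prop) (AH : VH → VH → Prop) (ρ : V → V → VH) (l : ℕ)
    (u v : V) : Prop :=
  ∃ n x, 1 ≤ n ∧ IsPath A n x ∧ x 0 = u ∧ x n = v ∧ HLenOpen AH ρ n x ≤ l

/-- `S` is `(k,H)`-independent: every path between two different vertices of `S`
has `H`-length at least `k`. -/
def KHIndependent (A : V → V → Prop) (AH : VH → VH → Prop) (ρ : V → V → VH)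
    (k : ℕ) (S : Set V) : Prop :=
  ∀ u ∈ S, ∀ v ∈ S, u ≠ v →
    ∀ n x, IsPath A n x → x 0 = u → x n = v → k ≤ HLenOpen AH ρ n x

/-- `S` is `(l,H)`-absorbent: from every vertex outside `S` there exists a path to some
vertex of `S` with `H`-length at most `l`. -/
def LHAbsorbent (A : V → V → Prop) (AH : VH → VH → Prop) (ρ : V → V → VH)
    (l : ℕ) (S : Set V) : Prop :=
  ∀ v ∉ S, ∃ w ∈ S, ∃ n x, IsPath A n x ∧ x 0 = v ∧ x n = w ∧ HLenOpen AH ρ n x ≤ l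

/-- A `(k,H)`-kernel: a `(k,H)`-independent and `(k-1,H)`-absorbent set of vertices. -/
def IsKHKernel (A : V → V → Prop) (AH : VH → VH → Prop) (ρ : V → V → VH)
    (k : ℕ) (S : Set V) : Prop :=
  KHIndependent A AH ρ k S ∧ LHAbsorbent A AH ρ (k - 1) S

/-- A kernel of a digraph: an independent and absorbent set of vertices. -/
def IsKernel (A : V → V → Prop) (S : Set V) : Prop :=
  (∀ u ∈ S, ∀ v ∈ S, u ≠ v → ¬ A u v) ∧ ∀ u ∉ S, ∃ v ∈ S, A u v

/-- A digraph is quasi-transitive if the endpoints of every path of length `2` are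
joined by an arc. -/
def QuasiTransitive (A : V → V → Prop) : Prop :=
  ∀ x : ℕ → V, IsPath A 2 x → A (x 0) (x 2) ∨ A (x 2) (x 0)

/-- `WalkRel A n u v`: there is a walk of length `n` from `u` to `v`. -/
def WalkRel (A : V → V → Prop) : ℕ → V → V → Prop
  | 0, u, v => u = v
  | n + 1, u, v => ∃ b, WalkRel A n u b ∧ A b v

/-- `AtDist A n u v`: the shortest walks from `u` to `v` have length `n`. -/
def AtDist (A : V → V → Prop) (n : ℕ) (u v : V) : Prop :=
  WalkRel A n u v ∧ ∀ m < n, ¬ WalkRel A m u v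

/-- `Near A u v`: there is a walk of length at most `3` from `u` to `v`. -/
def Near (A : V → V → Prop) (u v : V) : Prop :=
  ∃ n ≤ 3, WalkRel A n u v

/-- `v` absorbs, by walks of length at most `3`, every vertex that reaches it, and lies in a
terminal strong component. -/
def TerminalAbsorbing (A : V → V → Prop) (v : V) : Prop :=
  ∀ w, (Relation.ReflTransGen A v w → Relation.ReflTransGen A w v) ∧
    (Relation.ReflTransGen A w v → Near A w v)

section Distance

variable {A : V → V → Prop} {u v w a b c : V} {m n : ℕ}

theorem exists_walkRel (h : Relation.ReflTransGen A u v) : ∃ n, WalkRel A n u v := by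
  induction h with
  | refl => exact ⟨0, rfl⟩
  | tail _ hbc ih => exact ih.imp' Nat.succ fun n hn => ⟨_, hn, hbc⟩

theorem WalkRel.exists_atDist (h : WalkRel A n u v) : ∃ m ≤ n, AtDist A m u v := by
  have hex : ∃ n, WalkRel A n u v := ⟨n, h⟩
  exact ⟨Nat.find hex, Nat.find_min' hex h, Nat.find_spec hex, fun _ => Nat.find_min hex⟩

theorem near_of_adj (h : A u v) : Near A u v :=
  ⟨1, by omega, u, rfl, h⟩

theorem near_of_adj_adj (h₁ : A u w) (h₂ : A w v) : Near A u v :=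
  ⟨2, by omega, w, ⟨u, rfl, h₁⟩, h₂⟩

theorem AtDist.exists_pred (h : AtDist A (n + 1) u v) : ∃ b, AtDist A n u b ∧ A b v := by
  obtain ⟨⟨b, hb, hbv⟩, hmin⟩ := h
  exact ⟨b, ⟨hb, fun m hm hm' => hmin (m + 1) (by omega) ⟨b, hm', hbv⟩⟩, hbv⟩

theorem AtDist.unique (hm : AtDist A m u v) (hn : AtDist A n u v) : m = n := by
  rcases lt_trichotomy m n with h | h | h
  · exact absurd hm.1 (hn.2 m h)
  · exact h
  · exact absurd hn.1 (hm.2 n h)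

theorem AtDist.not_adj (hm : AtDist A m u a) (hn : AtDist A n u b) (h : m + 2 ≤ n) : ¬ A a b :=
  fun hab => hn.2 (m + 1) (by omega) ⟨a, hm.1, hab⟩

theorem AtDist.exists_isPath (h : AtDist A n u v) :
    ∃ x : ℕ → V, IsPath A n x ∧ x 0 = u ∧ x n = v := by
  suffices ∃ x : ℕ → V, IsWalk A n x ∧ x n = v ∧ ∀ i ≤ n, AtDist A i u (x i) by
    obtain ⟨x, hx, hxn, hd⟩ := this
    refine ⟨x, ⟨hx, fun i hi j hj hij => ?_⟩, (hd 0 n.zero_le).1.symm, hxn⟩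
    exact (hd i hi).unique (hij ▸ hd j hj)
  induction n generalizing v with
  | zero => exact ⟨fun _ => v, fun i hi => by omega, rfl, fun i hi => by
      obtain rfl : i = 0 := by omega
      exact h⟩
  | succ n ih =>
    obtain ⟨b, hb, hbv⟩ := h.exists_pred
    obtain ⟨x, hx, hxn, hd⟩ := ih hb
    refine ⟨fun i => if i ≤ n then x i else v, fun i hi => ?_, by simp, fun i hi => ?_⟩
    · rcases Nat.lt_succ_iff_lt_or_eq.1 hi with hi' | rfl
      · simpa [hi'.le, Nat.succ_le_of_lt hi'] using hx i hi'
      · simpa [hxn] using hbv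
    · by_cases hi' : i ≤ n
      · simpa [hi'] using hd i hi'
      · obtain rfl : i = n + 1 := by omega
        simpa using h

theorem IsWalk.reflTransGen {x : ℕ → V} (h : IsWalk A n x) :
    Relation.ReflTransGen A (x 0) (x n) := by
  induction n with
  | zero => exact .refl
  | succ n ih => exact (ih fun i hi => h i (by omega)).tail (h n (by omega))

theorem Near.exists_isPath {VH : Type*} (AH : VH → VH → Prop) (ρ : V → V → VH)
    (h : Near A u v) :
    ∃ n x, IsPath A n x ∧ x 0 = u ∧ x n = v ∧ HLenOpen AH ρ n x ≤ 3 := by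
  obtain ⟨n, hn, hw⟩ := h
  obtain ⟨m, hm, hd⟩ := hw.exists_atDist
  obtain ⟨x, hx, h0, hxm⟩ := hd.exists_isPath
  have hcard : (obstrOpen AH ρ m x).card ≤ (Finset.Ico 1 m).card := Finset.card_filter_le _ _
  rw [Nat.card_Ico] at hcard
  exact ⟨m, x, hx, h0, hxm, by unfold HLenOpen; omega⟩

end Distance

namespace QuasiTransitive

variable {A : V → V → Prop} {u v a b c : V} {n : ℕ}

theorem adj_or_adj (hqt : QuasiTransitive A) (hl : ∀ v, ¬ A v v)
    (hab : A a b) (hbc : A b c) (hac : a ≠ c) : A a c ∨ A c a := by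
  have hab' : a ≠ b := fun h => hl b (h ▸ hab)
  have hbc' : b ≠ c := fun h => hl c (h ▸ hbc)
  refine hqt (fun i => if i = 0 then a else if i = 1 then b else c) ⟨fun i hi => ?_, ?_⟩
  · interval_cases i <;> simpa
  · intro i hi j hj
    interval_cases i <;> interval_cases j <;> simp [hab', hbc', hac, hab'.symm, hbc'.symm, hac.symm]

/-- If `c` is at least two levels above `a`, a walk of length two between them, in either
direction, forces the backward arc. -/
theorem adj_of_atDist (hqt : QuasiTransitive A) (hl : ∀ v, ¬ A v v) {m : ℕ}
    (ha : AtDist A m u a) (hc : AtDist A n u c) (hmn : m + 2 ≤ n)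
    (h : A a b ∧ A b c ∨ A c b ∧ A b a) : A c a := by
  have hne : a ≠ c := by
    rintro rfl
    have := ha.unique hc
    omega
  have hn := ha.not_adj hc hmn
  rcases h with h | h
  · exact (hqt.adj_or_adj hl h.1 h.2 hne).resolve_left hn
  · exact (hqt.adj_or_adj hl h.1 h.2 hne.symm).resolve_right hn

theorem adj_of_four_le_dist (hqt : QuasiTransitive A) (hl : ∀ v, ¬ A v v) (hn : 4 ≤ n)
    (h : AtDist A n u v) : A v u := by
  have hu : AtDist A 0 u u := ⟨rfl, fun m hm => by omega⟩
  induction n, hn using Nat.le_induction generalizing v with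
  | base =>
    obtain ⟨b₃, hb₃, h₃⟩ := h.exists_pred
    obtain ⟨b₂, hb₂, h₂⟩ := hb₃.exists_pred
    obtain ⟨b₁, hb₁, h₁⟩ := hb₂.exists_pred
    obtain ⟨b₀, hb₀, h₀⟩ := hb₁.exists_pred
    obtain rfl : u = b₀ := hb₀.1
    exact hqt.adj_of_atDist hl hu h (by omega) (.inr
      ⟨hqt.adj_of_atDist hl hb₂ h (by omega) (.inl ⟨h₂, h₃⟩),
        hqt.adj_of_atDist hl hu hb₂ (by omega) (.inl ⟨h₀, h₁⟩)⟩)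
  | succ n hn ih =>
    obtain ⟨b, hb, hbv⟩ := h.exists_pred
    obtain ⟨n, rfl⟩ : ∃ k, n = k + 1 := ⟨n - 1, by omega⟩
    obtain ⟨w, hw, hwb⟩ := hb.exists_pred
    exact hqt.adj_of_atDist hl hu h (by omega) (.inr
      ⟨hqt.adj_of_atDist hl hw h (by omega) (.inl ⟨hwb, hbv⟩),
        hqt.adj_of_atDist hl hu hw (by omega) (.inr ⟨hwb, ih hb⟩)⟩)

theorem near_or_adj (hqt : QuasiTransitive A) (hl : ∀ v, ¬ A v v)
    (h : Relation.ReflTransGen A u v) : Near A u v ∨ A v u := by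
  obtain ⟨n, hn⟩ := exists_walkRel h
  obtain ⟨m, -, hm⟩ := hn.exists_atDist
  by_cases hm3 : m ≤ 3
  · exact .inl ⟨m, hm3, hm.1⟩
  · exact .inr (hqt.adj_of_four_le_dist hl (by omega) hm)

theorem adj_of_transGen (hqt : QuasiTransitive A) (hl : ∀ v, ¬ A v v)
    (h : Relation.TransGen (fun v w => A v w ∧ ¬ Near A w v) u v) : A u v := by
  induction h with
  | single h => exact h.1
  | @tail b c _ hbc ih =>
    have hne : u ≠ c := by
      rintro rfl
      exact hbc.2 (near_of_adj ih)
    exact (hqt.adj_or_adj hl ih hbc.1 hne).resolve_right fun hcu =>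
      hbc.2 (near_of_adj_adj hcu ih)

theorem wellFounded_adj_not_near [Finite V] (hqt : QuasiTransitive A) (hl : ∀ v, ¬ A v v) :
    WellFounded fun w v => A v w ∧ ¬ Near A w v := by
  let r : V → V → Prop := fun w v => A v w ∧ ¬ Near A w v
  have : Std.Irrefl (Relation.TransGen r) :=
    ⟨fun v h => hl v (hqt.adj_of_transGen hl (Relation.transGen_swap.1 h))⟩
  exact Subrelation.wf (q := r) (r := Relation.TransGen r) (fun h => .single h)
    (Finite.wellFounded_of_trans_of_irrefl _)

end QuasiTransitive

theorem exists_reflTransGen_terminal [Finite V] (A : V → V → Prop) (u : V) :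
    ∃ t, Relation.ReflTransGen A u t ∧
      ∀ w, Relation.ReflTransGen A t w → Relation.ReflTransGen A w t := by
  let r : V → V → Prop := fun w v =>
    Relation.ReflTransGen A v w ∧ ¬ Relation.ReflTransGen A w v
  have : IsTrans V r := ⟨fun a b c hab hbc => ⟨hbc.1.trans hab.1, fun h => hab.2 (h.trans hbc.1)⟩⟩
  have : Std.Irrefl r := ⟨fun a h => h.2 h.1⟩
  obtain ⟨t, ht, hmax⟩ := (Finite.wellFounded_of_trans_of_irrefl r).has_min
    {t | Relation.ReflTransGen A u t} ⟨u, .refl⟩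
  exact ⟨t, ht, fun w hw => by_contra fun h => hmax w (Relation.ReflTransGen.trans ht hw) ⟨hw, h⟩⟩

theorem QuasiTransitive.exists_terminalAbsorbing [Finite V] {A : V → V → Prop}
    (hqt : QuasiTransitive A) (hl : ∀ v, ¬ A v v) (u : V) :
    ∃ v, Relation.ReflTransGen A u v ∧ TerminalAbsorbing A v := by
  obtain ⟨t, hut, ht⟩ := exists_reflTransGen_terminal A u
  obtain ⟨v, hv, hmax⟩ := (hqt.wellFounded_adj_not_near hl).has_min
    {v | Relation.ReflTransGen A t v} ⟨t, .refl⟩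
  have htv : Relation.ReflTransGen A t v := hv
  refine ⟨v, hut.trans htv, fun w => ⟨fun hvw => (ht w (htv.trans hvw)).trans htv, fun hwv => ?_⟩⟩
  by_contra hnear
  have hadj := (hqt.near_or_adj hl hwv).resolve_left hnear
  exact hmax w (htv.tail hadj) ⟨hadj, hnear⟩

/-- Every `H`-colored quasi-transitive digraph has a `(k,H)`-kernel for every `k ≥ 4`. -/
theorem quasiTransitive_has_kHKernel [Fintype V]
    (A : V → V → Prop) (hloopless : ∀ v : V, ¬ A v v)
    (hqt : QuasiTransitive A)
    (AH : VH → VH → Prop) (ρ : V → V → VH)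
    (k : ℕ) (hk : 4 ≤ k) :
    ∃ S : Set V, IsKHKernel A AH ρ k S := by
  let s : Setoid {v // TerminalAbsorbing A v} :=
    { r := fun v w => Relation.ReflTransGen A v.1 w.1
      iseqv := ⟨fun _ => .refl, fun {v w} h => (v.2 w).1 h, fun h₁ h₂ => h₁.trans h₂⟩ }
  refine ⟨Set.range fun q : Quotient s => q.out.1, ?_, fun u _ => ?_⟩
  · rintro _ ⟨p, rfl⟩ _ ⟨q, rfl⟩ hne n x hx h0 hn
    refine absurd ?_ hne
    have hpq : Relation.ReflTransGen A (x 0) (x n) := hx.1.reflTransGen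
    rw [h0, hn] at hpq
    rw [Quotient.out_equiv_out.1 (show p.out ≈ q.out from hpq)]
  · obtain ⟨v, huv, hv⟩ := hqt.exists_terminalAbsorbing hloopless u
    have hvw : Relation.ReflTransGen A (Quotient.mk s ⟨v, hv⟩).out.1 v :=
      Quotient.mk_out (s := s) ⟨v, hv⟩
    refine ⟨_, ⟨Quotient.mk s ⟨v, hv⟩, rfl⟩, ?_⟩
    obtain ⟨n, x, hx, h0, hn, hlen⟩ := (((Quotient.mk s ⟨v, hv⟩).out.2 u).2
      (huv.trans (((Quotient.mk s ⟨v, hv⟩).out.2 v).1 hvw))).exists_isPath AH ρ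
    exact ⟨n, x, hx, h0, hn, by omega⟩
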